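/- arXiv:2501.07613 — 3 statements merged into one kernel-verified Lean document; each statement's English description precedes it below -/
import Mathlib

section
/- Let n > 2 and 1 ≤ s < n-1. Let x ∈ ℝⁿ and α = (α_1,…,α_s) ∈ ℝˢ satisfy Condition C (i.e. the polynomial t^s + α_1 t^{s-1} + ⋯ + α_s has only real roots; equivalently there exists β ∈ ℝˢ with α_i = e_i(β), the i-th elementary symmetric polynomial of β, for i = 1,…,s). Then for every k with s+1 ≤ k ≤ n-1, S_{k;s}(x)² ≥ S_{k-1;s}(x) · S_{k+1;s}(x). -/
/-- The `k`-th elementary symmetric polynomial of a vector `v ∈ ℝ^m`. -/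
noncomputable def esymmFin {m : ℕ} (v : Fin m → ℝ) (k : ℕ) : ℝ :=
  ∑ t ∈ Finset.univ.powersetCard k, ∏ i ∈ t, v i

/-- `σ_k(v)` with integer index: equals `esymmFin v k` for `0 ≤ k` (hence `0` for `k > m`),
and `0` for `k < 0`. -/
noncomputable def sigmaZ {m : ℕ} (v : Fin m → ℝ) (k : ℤ) : ℝ :=
  if 0 ≤ k then esymmFin v k.toNat else 0

/-- The `k`-th elementary symmetric mean `E_k(v) = σ_k(v) / C(m,k)`, integer index. -/
noncomputable def emeanZ {m : ℕ} (v : Fin m → ℝ) (k : ℤ) : ℝ :=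
  if 0 ≤ k then esymmFin v k.toNat / (m.choose k.toNat) else 0

/-- `S_{k;s}(x) = E_k(x) + ∑_{i=1}^s α_i E_{k-i}(x)`. -/
noncomputable def Ssk {n s : ℕ} (x : Fin n → ℝ) (α : Fin s → ℝ) (k : ℤ) : ℝ :=
  emeanZ x k + ∑ i : Fin s, α i * emeanZ x (k - ((i : ℕ) + 1))

/-- `Q_{k;s}(x) = σ_k(x) + ∑_{i=1}^s α_i σ_{k-i}(x)`. -/
noncomputable def Qks {n s : ℕ} (x : Fin n → ℝ) (α : Fin s → ℝ) (k : ℤ) : ℝ :=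
  sigmaZ x k + ∑ i : Fin s, α i * sigmaZ x (k - ((i : ℕ) + 1))

/-- Condition C: `t^s + α_1 t^{s-1} + ⋯ + α_s` has only real roots `-β_1,…,-β_s`;
equivalently `α_i = e_i(β)` for some `β ∈ ℝ^s`. -/
def ConditionC {s : ℕ} (α : Fin s → ℝ) : Prop :=
  ∃ β : Fin s → ℝ, ∀ i : Fin s, α i = esymmFin β ((i : ℕ) + 1)

open Polynomial in
theorem Polynomial.coeff_X_mul_derivative {R : Type*} [CommSemiring R] (f : R[X]) (m : ℕ) :
    (X * derivative f).coeff m = m * f.coeff m := by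
  cases m with
  | zero => simp
  | succ m => rw [coeff_X_mul, coeff_derivative]; push_cast; ring

open Polynomial in
theorem Polynomial.Splits.derivative_real {f : ℝ[X]} (hf : f.Splits) :
    (derivative f).Splits := by
  rw [splits_iff_card_roots]
  have h1 := card_roots_le_derivative f
  have h2 := (derivative f).card_roots'
  have h3 := natDegree_derivative_le f
  have h4 := hf.natDegree_eq_card_roots
  by_cases h : f.natDegree = 0
  · rw [eq_C_of_natDegree_eq_zero h]
    simp
  · omega

open Polynomial in
theorem Polynomial.Splits.reverse {K : Type*} [Field K] {f : K[X]} (hf : f.Splits) :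
    f.reverse.Splits := by
  obtain ⟨m, hm⟩ := splits_iff_exists_multiset.mp hf
  rw [hm, reverse_mul_of_domain]
  refine Splits.mul (Splits.of_natDegree_eq_zero ?_) ?_
  · simp
  · clear hm
    induction m using Multiset.induction with
    | empty =>
      rw [Multiset.map_zero, Multiset.prod_zero]
      exact Splits.of_natDegree_eq_zero (by simpa using reverse_natDegree_le (1 : K[X]))
    | cons a m ih =>
      rw [Multiset.map_cons, Multiset.prod_cons, reverse_mul_of_domain]
      exact Splits.mul (Splits.of_natDegree_le_one
        ((reverse_natDegree_le _).trans (natDegree_X_sub_C a).le)) ih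

open Polynomial in
theorem Polynomial.Splits.reflect {K : Type*} [Field K] {f : K[X]} (hf : f.Splits) {N : ℕ}
    (hN : f.natDegree ≤ N) : (f.reflect N).Splits := by
  have h := reflect_mul f (1 : K[X]) le_rfl (G := N - f.natDegree) (by simp)
  rw [mul_one, Nat.add_sub_cancel' hN] at h
  rw [h, ← C_1, reflect_C]
  exact hf.reverse.mul (Splits.C_mul_X_pow _ _)

open Polynomial in
theorem Polynomial.Splits.succ_mul_sub_X_mul_derivative {f : ℝ[X]} (hf : f.Splits) {N : ℕ}
    (hN : f.natDegree ≤ N + 1) :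
    (C ((N : ℝ) + 1) * f - X * derivative f).Splits := by
  have key : C ((N : ℝ) + 1) * f - X * derivative f
      = (derivative (f.reflect (N + 1))).reflect N := by
    ext m
    have hz : ∀ j, N + 1 < j → f.coeff j = 0 := fun j hj =>
      coeff_eq_zero_of_natDegree_lt (hN.trans_lt hj)
    rw [coeff_sub, coeff_C_mul, coeff_X_mul_derivative, coeff_reflect, coeff_derivative, coeff_reflect]
    rcases le_or_gt m N with h | h
    · rw [revAt_le h, revAt_le (by omega), show N + 1 - (N - m + 1) = m by omega,
        Nat.cast_sub h]
      ring
    · rw [revAt_eq_self_of_lt h, revAt_eq_self_of_lt (by omega), hz (m + 1) (by omega)]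
      rcases eq_or_lt_of_le (Nat.succ_le_of_lt h) with rfl | h'
      · push_cast; ring
      · rw [hz m h']; ring
  rw [key]
  refine Splits.reflect (Splits.derivative_real (hf.reflect hN)) ?_
  refine (natDegree_derivative_le _).trans ?_
  have : (f.reflect (N + 1)).natDegree ≤ N + 1 := by
    refine natDegree_le_iff_coeff_eq_zero.mpr fun j hj => ?_
    rw [coeff_reflect, revAt_eq_self_of_lt hj]
    exact coeff_eq_zero_of_natDegree_lt (hN.trans_lt hj)
  omega

open Polynomial in
/-- The polar derivative `(N + 1) f - (X - β) f'` of a real-rooted polynomial of degree at most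
`N + 1` is real-rooted. -/
theorem Polynomial.Splits.polar_derivative {f : ℝ[X]} (hf : f.Splits) {N : ℕ}
    (hN : f.natDegree ≤ N + 1) (β : ℝ) :
    (C ((N : ℝ) + 1) * f - (X - C β) * derivative f).Splits := by
  have h := (hf.comp_X_add_C β).succ_mul_sub_X_mul_derivative (N := N)
    (by rwa [natDegree_comp, natDegree_X_add_C, mul_one])
  have h' := h.comp_X_sub_C β
  have e : (X + C β).comp (X - C β) = (X : ℝ[X]) := by simp
  simpa [derivative_comp, comp_assoc, e] using h'

open Polynomial in
/-- The binary form `∑ C(n,j) a_j t^(n-j) u^j` is a product of real linear forms (or zero). -/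
def IsRealRootedSeq (n : ℕ) (a : ℕ → ℝ) : Prop :=
  ∃ f : ℝ[X], f.Splits ∧ ∀ m, f.coeff m = n.choose m * a (n - m)

namespace IsRealRootedSeq

open Polynomial

variable {n : ℕ} {a : ℕ → ℝ}

theorem natDegree_le {f : ℝ[X]} (h : ∀ m, f.coeff m = n.choose m * a (n - m)) :
    f.natDegree ≤ n :=
  natDegree_le_iff_coeff_eq_zero.mpr fun j hj => by rw [h, Nat.choose_eq_zero_of_lt hj]; simp

theorem coeff_derivative_eq {f : ℝ[X]} (h : ∀ m, f.coeff m = (n + 1).choose m * a (n + 1 - m))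
    (m : ℕ) : (derivative f).coeff m = ((n : ℝ) + 1) * (n.choose m * a (n - m)) := by
  have := congrArg (Nat.cast (R := ℝ)) (Nat.add_one_mul_choose_eq n m)
  push_cast at this
  rw [coeff_derivative, h, Nat.add_sub_add_right, ← mul_assoc, this]
  ring

theorem coeff_succ_mul_sub {f : ℝ[X]}
    (h : ∀ m, f.coeff m = (n + 1).choose m * a (n + 1 - m)) (m : ℕ) :
    (C ((n : ℝ) + 1) * f - X * derivative f).coeff m =
      ((n : ℝ) + 1) * (n.choose m * a (n - m + 1)) := by
  rw [coeff_sub, coeff_C_mul, coeff_X_mul_derivative, h]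
  rcases le_or_gt m n with hm | hm
  · have := congrArg (Nat.cast (R := ℝ)) (Nat.choose_mul_succ_eq n m)
    rw [show n + 1 - m = n - m + 1 by omega] at this ⊢
    push_cast [Nat.cast_sub hm] at this
    linear_combination (-a (n - m + 1)) * this
  · rw [Nat.choose_eq_zero_of_lt hm]
    rcases eq_or_lt_of_le (Nat.succ_le_of_lt hm) with rfl | hm'
    · push_cast; ring
    · rw [Nat.choose_eq_zero_of_lt hm']; simp

theorem truncate (h : IsRealRootedSeq (n + 1) a) : IsRealRootedSeq n a := by
  obtain ⟨f, hf, hc⟩ := h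
  refine ⟨C ((n : ℝ) + 1)⁻¹ * derivative f, hf.derivative_real.C_mul _, fun m => ?_⟩
  rw [coeff_C_mul, coeff_derivative_eq hc, inv_mul_cancel_left₀ (by positivity)]

theorem shift_add_mul (h : IsRealRootedSeq (n + 1) a) (β : ℝ) :
    IsRealRootedSeq n fun j => a (j + 1) + β * a j := by
  obtain ⟨f, hf, hc⟩ := h
  refine ⟨C ((n : ℝ) + 1)⁻¹ * (C ((n : ℝ) + 1) * f - (X - C β) * derivative f),
    (hf.polar_derivative (natDegree_le hc) β).C_mul _, fun m => ?_⟩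
  rw [show C ((n : ℝ) + 1) * f - (X - C β) * derivative f =
    (C ((n : ℝ) + 1) * f - X * derivative f) + C β * derivative f by ring, coeff_C_mul, coeff_add,
    coeff_C_mul, coeff_succ_mul_sub hc, coeff_derivative_eq hc]
  have : (n : ℝ) + 1 ≠ 0 := by positivity
  field_simp

theorem shift (h : IsRealRootedSeq (n + 1) a) : IsRealRootedSeq n fun j => a (j + 1) := by
  simpa using h.shift_add_mul 0

theorem newton_two (h : IsRealRootedSeq 2 a) : a 0 * a 2 ≤ a 1 ^ 2 := by
  obtain ⟨f, hf, hc⟩ := h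
  rcases eq_or_ne (a 0) 0 with h0 | h0
  · rw [h0, zero_mul]; positivity
  have c0 := hc 0
  have c1 := hc 1
  have c2 := hc 2
  norm_num at c0 c1 c2
  have hd : f.natDegree = 2 := natDegree_eq_of_le_of_coeff_ne_zero (natDegree_le hc) (c2 ▸ h0)
  obtain ⟨r, hr⟩ := hf.exists_eval_eq_zero fun h => by
    have := natDegree_eq_of_degree_eq_some (n := 0) h
    omega
  rw [eval_eq_sum_range, hd] at hr
  simp only [Finset.sum_range_succ, Finset.sum_range_zero, c0, c1, c2] at hr
  have := discrim_eq_sq_of_quadratic_eq_zero (a := a 0) (b := 2 * a 1) (c := a 2) (x := r)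
    (by linear_combination hr)
  rw [discrim] at this
  nlinarith [sq_nonneg (2 * a 0 * r + 2 * a 1)]

theorem newton (j d : ℕ) (h : IsRealRootedSeq (j + 2 + d) a) :
    a j * a (j + 2) ≤ a (j + 1) ^ 2 := by
  induction d with
  | succ d ih => exact ih h.truncate
  | zero =>
    induction j generalizing a with
    | zero => exact newton_two h
    | succ j ih =>
      refine ih (a := fun i => a (i + 1)) (shift ?_)
      rwa [show j + 2 + 0 + 1 = j + 1 + 2 + 0 by omega]

/-- The forward shift on real sequences. -/
def shiftEnd : Module.End ℝ (ℕ → ℝ) := LinearMap.funLeft ℝ ℝ Nat.succ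

theorem shiftEnd_pow_apply (m : ℕ) (a : ℕ → ℝ) (j : ℕ) : (shiftEnd ^ m) a j = a (j + m) := by
  induction m generalizing a with
  | zero => simp
  | succ m ih =>
    rw [pow_succ, Module.End.mul_apply, ih]
    rfl

theorem aeval_shiftEnd_apply (p : ℝ[X]) (a : ℕ → ℝ) (j : ℕ) :
    (aeval shiftEnd p) a j = ∑ m ∈ Finset.range (p.natDegree + 1), p.coeff m * a (j + m) := by
  rw [aeval_eq_sum_range, LinearMap.sum_apply, Finset.sum_apply]
  simp [shiftEnd_pow_apply]

theorem aeval_prod {ι : Type*} (t : Finset ι) (β : ι → ℝ) (h : IsRealRootedSeq (n + t.card) a) :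
    IsRealRootedSeq n (aeval shiftEnd (∏ i ∈ t, (X + C (β i))) a) := by
  classical
  induction t using Finset.induction_on generalizing n with
  | empty => simpa using h
  | insert i t hi ih =>
    rw [Finset.card_insert_of_notMem hi, add_comm t.card, ← add_assoc] at h
    have := (ih h).shift_add_mul (β i)
    rw [Finset.prod_insert hi]
    convert! this using 1
    ext j
    simp [shiftEnd]

end IsRealRootedSeq

open Polynomial in
theorem isRealRootedSeq_emeanZ {n : ℕ} (x : Fin n → ℝ) :
    IsRealRootedSeq n fun j => emeanZ x j := by
  have hd : (∏ i, (X + C (x i))).natDegree = n := by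
    rw [natDegree_prod_of_monic _ _ fun i _ => monic_X_add_C (x i)]
    simp
  refine ⟨∏ i, (X + C (x i)), Splits.prod fun i _ => Splits.X_add_C _, fun m => ?_⟩
  rcases le_or_gt m n with hm | hm
  · rw [Finset.prod_X_add_C_coeff _ _ (by simpa using hm)]
    have : (n.choose m : ℝ) ≠ 0 := by exact_mod_cast (Nat.choose_pos hm).ne'
    simp only [emeanZ, Int.natCast_nonneg, if_true, Int.toNat_natCast, Nat.choose_symm hm,
      esymmFin, Finset.card_univ, Fintype.card_fin]
    field_simp
  · rw [coeff_eq_zero_of_natDegree_lt (hd.trans_lt hm), Nat.choose_eq_zero_of_lt hm]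
    simp

open Polynomial in
theorem Ssk_eq_aeval_shiftEnd {n s : ℕ} (x : Fin n → ℝ) (α β : Fin s → ℝ)
    (h : ∀ i : Fin s, α i = esymmFin β ((i : ℕ) + 1)) (j : ℕ) :
    Ssk x α ((j + s : ℕ) : ℤ) = aeval IsRealRootedSeq.shiftEnd (∏ i, (X + C (β i)))
      (fun j : ℕ => emeanZ x j) j := by
  have hd : (∏ i, (X + C (β i))).natDegree = s := by
    rw [natDegree_prod_of_monic _ _ fun i _ => monic_X_add_C (β i)]
    simp
  rw [IsRealRootedSeq.aeval_shiftEnd_apply, hd, ← Finset.sum_range_reflect,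
    Finset.sum_range_succ', Ssk, add_comm (emeanZ x _)]
  have hc : ∀ m ≤ s, (∏ i, (X + C (β i))).coeff (s - m) = esymmFin β m := fun m hm => by
    rw [Finset.prod_X_add_C_coeff _ _ (by simp)]
    simp [esymmFin, Nat.sub_sub_self hm]
  congr 1
  · rw [Finset.sum_range]
    refine Finset.sum_congr rfl fun i _ => ?_
    rw [Nat.add_sub_cancel, hc _ i.2, h]
    congr 2
    have := i.2
    omega
  · have := hc 0 (Nat.zero_le s)
    simp only [Nat.sub_zero] at this
    simp [this, esymmFin]

/-- Newton-type inequality for `S_{k;s}`: if α satisfies Condition C then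
`S_{k;s}(x)² ≥ S_{k-1;s}(x) S_{k+1;s}(x)` for all `s+1 ≤ k ≤ n-1`. -/
theorem newton_inequality_Ssk (n s : ℕ) (hn : 2 < n) (hs1 : 1 ≤ s) (hs2 : s < n - 1)
    (x : Fin n → ℝ) (α : Fin s → ℝ) (hC : ConditionC α) :
    ∀ k : ℤ, (s : ℤ) + 1 ≤ k → k ≤ (n : ℤ) - 1 →
      Ssk x α (k - 1) * Ssk x α (k + 1) ≤ Ssk x α k ^ 2 := by
  intro k hk1 hk2
  obtain ⟨β, hβ⟩ := hC
  obtain ⟨j, rfl⟩ : ∃ j : ℕ, k = ((j + 1 + s : ℕ) : ℤ) := ⟨(k - s - 1).toNat, by omega⟩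
  obtain ⟨d, hd⟩ : ∃ d, n = j + 2 + d + s := ⟨n - (j + 2 + s), by omega⟩
  have hx := isRealRootedSeq_emeanZ x
  have hb : IsRealRootedSeq (j + 2 + d)
      (Polynomial.aeval IsRealRootedSeq.shiftEnd (∏ i, (Polynomial.X + Polynomial.C (β i)))
        (fun j : ℕ => emeanZ x j)) :=
    IsRealRootedSeq.aeval_prod _ _ (by
      rw [Finset.card_univ, Fintype.card_fin, ← hd]
      exact hx)
  have hnewton := hb.newton j d
  simp only [← Ssk_eq_aeval_shiftEnd x α β hβ] at hnewton
  convert hnewton using 3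
  · push_cast; ring
  · push_cast; ring
end

section
/- Let n ≥ 2, 1 ≤ s < n-1, x ∈ ℝⁿ, and α ∈ ℝˢ satisfying Condition C. Then for every k with 1 ≤ k ≤ n, Q_{k;s}(x)² − Q_{k-1;s}(x) · Q_{k+1;s}(x) ≥ θ · Q_{k;s}(x)², where θ = ((C(n+s,k))² − C(n+s,k-1)·C(n+s,k+1)) / (C(n+s,k))², and this θ is a positive constant. -/
open Polynomial in
theorem Polynomial.Splits.derivative_real_s5 {p : ℝ[X]} (hp : p.Splits) : (derivative p).Splits := by
  have h1 := p.card_roots_le_derivative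
  have h2 := (derivative p).card_roots'
  have h3 := natDegree_derivative_le p
  rw [splits_iff_card_roots] at hp ⊢
  omega

open Polynomial in
theorem Polynomial.Splits.reverse_of_field {K : Type*} [Field K] {p : K[X]} (hp : p.Splits) :
    p.reverse.Splits := by
  obtain ⟨m, hm⟩ := splits_iff_exists_multiset.1 hp
  rw [hm, reverse_mul_of_domain, reverse_C]
  refine Splits.C_mul ?_ _
  clear hm
  induction m using Multiset.induction_on with
  | empty => rw [Multiset.map_zero, Multiset.prod_zero, ← C_1, reverse_C]; exact Splits.C 1
  | cons a m ih =>
    rw [Multiset.map_cons, Multiset.prod_cons, reverse_mul_of_domain]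
    refine Splits.mul (Splits.of_natDegree_le_one ?_) ih
    exact (reverse_natDegree_le _).trans (natDegree_X_sub_C_le a)

open Polynomial in
theorem Polynomial.Splits.reflect_of_natDegree_le {K : Type*} [Field K] {p : K[X]}
    (hp : p.Splits) {N : ℕ} (hN : p.natDegree ≤ N) : (p.reflect N).Splits := by
  have h := reflect_mul (1 : K[X]) p (F := N - p.natDegree) (G := p.natDegree) (by simp) le_rfl
  rw [Nat.sub_add_cancel hN, one_mul, reflect_one] at h
  rw [h]
  exact (Splits.X_pow _).mul hp.reverse_of_field

open Polynomial in
theorem Polynomial.Splits.four_mul_coeff_mul_coeff_le {p : ℝ[X]} (hp : p.Splits)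
    (hdeg : p.natDegree ≤ 2) : 4 * (p.coeff 0 * p.coeff 2) ≤ p.coeff 1 ^ 2 := by
  by_cases h2 : p.coeff 2 = 0
  · rw [h2]
    nlinarith [sq_nonneg (p.coeff 1)]
  · have hd : p.natDegree = 2 := le_antisymm hdeg (le_natDegree_of_ne_zero h2)
    obtain ⟨x, hx⟩ := hp.exists_eval_eq_zero (by
      intro h
      have h0 : p.natDegree = 0 := natDegree_eq_of_degree_eq_some h
      omega)
    rw [eval_eq_sum_range, hd] at hx
    simp only [Finset.sum_range_succ, Finset.sum_range_zero, pow_zero, pow_one] at hx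
    have hc : p.coeff 1 ^ 2 - 4 * (p.coeff 0 * p.coeff 2)
        = (2 * p.coeff 2 * x + p.coeff 1) ^ 2 := by
      linear_combination (-4 * p.coeff 2) * hx
    linarith [sq_nonneg (2 * p.coeff 2 * x + p.coeff 1)]

open Polynomial in
theorem Polynomial.coeff_derivative_div_choose (p : ℝ[X]) (N k : ℕ) (hk : k ≤ N) :
    (derivative p).coeff k / (N.choose k : ℝ)
      = (N + 1) * (p.coeff (k + 1) / ((N + 1).choose (k + 1) : ℝ)) := by
  have h : ((N : ℝ) + 1) * N.choose k = (N + 1).choose (k + 1) * ((k : ℝ) + 1) := by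
    exact_mod_cast Nat.add_one_mul_choose_eq N k
  have h1 : (N.choose k : ℝ) ≠ 0 := by exact_mod_cast (Nat.choose_pos hk).ne'
  have h2 : ((N + 1).choose (k + 1) : ℝ) ≠ 0 := by
    exact_mod_cast (Nat.choose_pos (Nat.succ_le_succ hk)).ne'
  rw [coeff_derivative, mul_div_assoc', div_eq_div_iff h1 h2]
  linear_combination (-p.coeff (k + 1)) * h

open Polynomial in
/-- **Newton's inequality** for the coefficients of a real-rooted polynomial of degree at most
`N`. -/
theorem Polynomial.Splits.newton_inequality {N : ℕ} {p : ℝ[X]} (hp : p.Splits)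
    (hdeg : p.natDegree ≤ N) {k : ℕ} (hk : k + 2 ≤ N) :
    p.coeff k / (N.choose k : ℝ) * (p.coeff (k + 2) / (N.choose (k + 2) : ℝ))
      ≤ (p.coeff (k + 1) / (N.choose (k + 1) : ℝ)) ^ 2 := by
  induction N generalizing p k with
  | zero => omega
  | succ N ih =>
    have step : ∀ {q : ℝ[X]}, q.Splits → q.natDegree ≤ N + 1 → ∀ {j : ℕ}, j + 3 ≤ N + 1 →
        q.coeff (j + 1) / ((N + 1).choose (j + 1) : ℝ)
            * (q.coeff (j + 3) / ((N + 1).choose (j + 3) : ℝ))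
          ≤ (q.coeff (j + 2) / ((N + 1).choose (j + 2) : ℝ)) ^ 2 := by
      intro q hq hqd j hj
      have h := ih hq.derivative_real_s5 ((natDegree_derivative_le q).trans (by omega))
        (k := j) (by omega)
      rw [coeff_derivative_div_choose q N j (by omega),
        coeff_derivative_div_choose q N (j + 1) (by omega),
        coeff_derivative_div_choose q N (j + 2) (by omega)] at h
      have hN : (0 : ℝ) < ((N : ℝ) + 1) ^ 2 := by positivity
      refine le_of_mul_le_mul_left ?_ hN
      calc _ = _ := by ring
        _ ≤ _ := h
        _ = _ := by ring
    rcases k with _ | j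
    · rcases Nat.lt_or_ge N 2 with h | h
      · obtain rfl : N = 1 := by omega
        have := hp.four_mul_coeff_mul_coeff_le hdeg
        norm_num [Nat.choose]
        nlinarith
      · obtain ⟨M, rfl⟩ := Nat.exists_eq_add_of_le' h
        have h := step (hp.reflect_of_natDegree_le hdeg)
          (natDegree_reflect_le.trans (max_le le_rfl hdeg)) (j := M) (by omega)
        rw [coeff_reflect, coeff_reflect, coeff_reflect, revAt_le (by omega),
          revAt_le (by omega), revAt_le (by omega),
          ← Nat.choose_symm (n := M + 2 + 1) (k := M + 1) (by omega),
          ← Nat.choose_symm (n := M + 2 + 1) (k := M + 2) (by omega),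
          ← Nat.choose_symm (n := M + 2 + 1) (k := M + 3) (by omega),
          show M + 2 + 1 - (M + 1) = 2 by omega, show M + 2 + 1 - (M + 2) = 1 by omega,
          show M + 2 + 1 - (M + 3) = 0 by omega, mul_comm] at h
        exact h
    · exact step hp hdeg hk

theorem Nat.choose_mul_choose_lt_choose_sq {N k : ℕ} (hk : k + 1 ≤ N) :
    N.choose k * N.choose (k + 2) < N.choose (k + 1) ^ 2 := by
  have h1 := Nat.choose_succ_right_eq N k
  have h2 := Nat.choose_succ_right_eq N (k + 1)
  obtain ⟨d, rfl⟩ := Nat.exists_eq_add_of_le hk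
  rw [show k + 1 + d - k = d + 1 by omega] at h1
  rw [show k + 1 + d - (k + 1) = d by omega] at h2
  have hb : 0 < (k + 1 + d).choose (k + 1) := Nat.choose_pos hk
  set a := (k + 1 + d).choose k
  set b := (k + 1 + d).choose (k + 1)
  set c := (k + 1 + d).choose (k + 2)
  have h3 : (a * c) * ((d + 1) * (k + 2)) = b ^ 2 * (d * (k + 1)) := by
    calc (a * c) * ((d + 1) * (k + 2)) = (a * (d + 1)) * (c * (k + 1 + 1)) := by ring
      _ = b ^ 2 * (d * (k + 1)) := by rw [← h1, h2]; ring
  have h4 : b ^ 2 * (d * (k + 1)) < b ^ 2 * ((d + 1) * (k + 2)) :=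
    Nat.mul_lt_mul_of_pos_left (by nlinarith) (by positivity)
  exact Nat.lt_of_mul_lt_mul_right (h3 ▸ h4)

open Polynomial in
/-- The polynomial `∏ i, (1 + v i * X)`, whose coefficients are the `esymmFin v k`. -/
noncomputable def esymmGen {m : ℕ} (v : Fin m → ℝ) : ℝ[X] := ∏ i, (1 + C (v i) * X)

open Polynomial in
theorem coeff_esymmGen {m : ℕ} (v : Fin m → ℝ) (k : ℕ) :
    (esymmGen v).coeff k = esymmFin v k := by
  rw [esymmGen, Finset.prod_one_add, finsetSum_coeff, esymmFin, Finset.powersetCard_eq_filter,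
    Finset.sum_filter]
  refine Finset.sum_congr rfl fun t _ => ?_
  rw [Finset.prod_mul_distrib, Finset.prod_const, ← map_prod, coeff_C_mul_X_pow]
  simp only [eq_comm]

open Polynomial in
theorem splits_esymmGen {m : ℕ} (v : Fin m → ℝ) : (esymmGen v).Splits :=
  Splits.prod fun i _ => Splits.of_natDegree_le_one (by compute_degree)

open Polynomial in
theorem natDegree_esymmGen_le {m : ℕ} (v : Fin m → ℝ) : (esymmGen v).natDegree ≤ m := by
  refine (natDegree_prod_le _ _).trans ?_
  calc _ ≤ ∑ _i : Fin m, 1 := Finset.sum_le_sum fun i _ => by compute_degree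
    _ = m := by simp

open Polynomial in
theorem coeff_mul_esymmGen_eq_Qks {n s : ℕ} (x : Fin n → ℝ) {α β : Fin s → ℝ}
    (h : ∀ i : Fin s, α i = esymmFin β ((i : ℕ) + 1)) (k : ℕ) :
    (esymmGen x * esymmGen β).coeff k = Qks x α (k : ℤ) := by
  have hterm : ∀ j : ℕ, (esymmGen x * (C (esymmFin β j) * X ^ j)).coeff k
      = esymmFin β j * sigmaZ x ((k : ℤ) - j) := by
    intro j
    rw [mul_left_comm, coeff_C_mul, coeff_mul_X_pow', sigmaZ, coeff_esymmGen]
    by_cases hj : j ≤ k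
    · rw [if_pos hj, if_pos (by omega), show ((k : ℤ) - j).toNat = k - j by omega]
    · rw [if_neg hj, if_neg (by omega)]
  have h0 : esymmFin β 0 = 1 := by simp [esymmFin]
  rw [(esymmGen β).as_sum_range_C_mul_X_pow' (Nat.lt_succ_of_le (natDegree_esymmGen_le β)),
    Finset.mul_sum, finsetSum_coeff]
  simp only [coeff_esymmGen, hterm]
  rw [Finset.sum_range_succ', Finset.sum_range, Qks, add_comm, h0]
  simp [h]

/-- Newton-type inequality with gap for `Q_{k;s}`:
`Q_{k;s}(x)² − Q_{k-1;s}(x) Q_{k+1;s}(x) ≥ θ Q_{k;s}(x)²` with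
`θ = (C(n+s,k)² − C(n+s,k-1) C(n+s,k+1)) / C(n+s,k)² > 0`. -/
theorem newton_inequality_Qks (n s : ℕ) (hn : 2 ≤ n) (hs1 : 1 ≤ s) (hs2 : s < n - 1)
    (x : Fin n → ℝ) (α : Fin s → ℝ) (hC : ConditionC α) :
    ∀ k : ℕ, 1 ≤ k → k ≤ n →
      0 < ((((n + s).choose k : ℝ)) ^ 2
            - ((n + s).choose (k - 1) : ℝ) * ((n + s).choose (k + 1) : ℝ))
          / (((n + s).choose k : ℝ)) ^ 2
      ∧ ((((n + s).choose k : ℝ)) ^ 2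
            - ((n + s).choose (k - 1) : ℝ) * ((n + s).choose (k + 1) : ℝ))
          / (((n + s).choose k : ℝ)) ^ 2 * Qks x α (k : ℤ) ^ 2
        ≤ Qks x α (k : ℤ) ^ 2 - Qks x α ((k : ℤ) - 1) * Qks x α ((k : ℤ) + 1) := by
  obtain ⟨β, hβ⟩ := hC
  intro k hk1 hkn
  obtain ⟨m, rfl⟩ := Nat.exists_eq_add_of_le' hk1
  have hlt : ((n + s).choose m : ℝ) * ((n + s).choose (m + 2) : ℝ)
      < ((n + s).choose (m + 1) : ℝ) ^ 2 := by
    exact_mod_cast Nat.choose_mul_choose_lt_choose_sq (N := n + s) (k := m) (by omega)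
  have ha : (0 : ℝ) < (n + s).choose m := by exact_mod_cast Nat.choose_pos (by omega)
  have hb : (0 : ℝ) < (n + s).choose (m + 1) := by exact_mod_cast Nat.choose_pos (by omega)
  have hc : (0 : ℝ) < (n + s).choose (m + 2) := by exact_mod_cast Nat.choose_pos (by omega)
  have hN := ((splits_esymmGen x).mul (splits_esymmGen β)).newton_inequality (N := n + s) (k := m)
    (Polynomial.natDegree_mul_le.trans
      (add_le_add (natDegree_esymmGen_le x) (natDegree_esymmGen_le β))) (by omega)
  simp only [coeff_mul_esymmGen_eq_Qks x hβ] at hN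
  rw [show ((m + 1 : ℕ) : ℤ) - 1 = (m : ℕ) by push_cast; ring,
    show ((m + 1 : ℕ) : ℤ) + 1 = (m + 2 : ℕ) by push_cast; ring, Nat.add_sub_cancel,
    show m + 1 + 1 = m + 2 from rfl]
  refine ⟨div_pos (sub_pos.2 hlt) (by positivity), ?_⟩
  generalize Qks x α (m : ℕ) = q₀ at *
  generalize Qks x α (m + 1 : ℕ) = q₁ at *
  generalize Qks x α (m + 2 : ℕ) = q₂ at *
  generalize ((n + s).choose m : ℝ) = a at *
  generalize ((n + s).choose (m + 1) : ℝ) = b at *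
  generalize ((n + s).choose (m + 2) : ℝ) = c at *
  have key : q₀ * q₂ ≤ a * c / b ^ 2 * q₁ ^ 2 := by
    calc q₀ * q₂ = (a * c) * (q₀ / a * (q₂ / c)) := by field_simp
      _ ≤ (a * c) * (q₁ / b) ^ 2 := mul_le_mul_of_nonneg_left hN (by positivity)
      _ = a * c / b ^ 2 * q₁ ^ 2 := by field_simp
  have hsplit : (b ^ 2 - a * c) / b ^ 2 * q₁ ^ 2 = q₁ ^ 2 - a * c / b ^ 2 * q₁ ^ 2 := by
    field_simp
  linarith
end

section
/- Let n ≥ 3 and x₁ < x₂ < ⋯ < x_n be real numbers. Set P(t) = ∏_{i=1}^{n}(t - x_i), P₁(t) = P'(t)/n, and P₂(t) = t·P₁(t) − P(t). Then all real roots of P₁ and all real roots of P₂ are simple, and the real roots of P₁ and P₂ are interleaved: if y₁ < y₂ < ⋯ < y_{n-1} denote the roots of P₁ (which are all real and simple by Rolle's theorem), then P₂ has exactly one real root in each open interval (y_i, y_{i+1}), i = 1,…,n-2. -/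
open Polynomial in
/-- The strict Laguerre inequality for a product of at least two distinct linear factors. -/
theorem laguerre_pos_of_two_le_card (s : Finset ℝ) (hs : 2 ≤ s.card) (t : ℝ) :
    0 < ((s.card : ℝ) - 1) * (derivative (∏ a ∈ s, (X - C a))).eval t ^ 2
      - s.card * (∏ a ∈ s, (X - C a)).eval t
        * (derivative (derivative (∏ a ∈ s, (X - C a)))).eval t := by
  induction s using Finset.induction_on with
  | empty => simp at hs
  | insert a s ha ih =>
    rw [Finset.card_insert_of_notMem ha] at hs ⊢
    rw [Finset.prod_insert ha]
    obtain h1 | h2 : s.card = 1 ∨ 2 ≤ s.card := by omega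
    · obtain ⟨b, rfl⟩ := Finset.card_eq_one.mp h1
      have hab : a - b ≠ 0 := sub_ne_zero.mpr (by simpa using ha)
      have := sq_pos_of_ne_zero hab
      simp [derivative_mul]
      linarith
    · have hL := ih h2
      have hpa : t = a → (∏ b ∈ s, (X - C b)).eval t ≠ 0 := by
        rintro rfl
        rw [eval_prod, Finset.prod_ne_zero_iff]
        intro b hb
        simpa [sub_ne_zero] using fun h : t = b => ha (h ▸ hb)
      have hm : (0 : ℝ) < s.card := by exact_mod_cast (by omega : 0 < s.card)
      generalize (∏ b ∈ s, (X - C b)) = p at hL hpa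
      simp only [derivative_mul, derivative_add, derivative_sub, derivative_X, derivative_C,
        sub_zero, one_mul, eval_add, eval_mul, eval_sub, eval_X, eval_C]
      push_cast
      generalize (s.card : ℝ) = m at *
      generalize eval t p = p₀ at *
      generalize eval t (derivative p) = p₁ at *
      generalize eval t (derivative (derivative p)) = p₂ at *
      refine pos_of_mul_pos_right (a := m) ?_ hm.le
      have key : 0 < (m * p₀ - (t - a) * p₁) ^ 2
          + (t - a) ^ 2 * (m + 1) * ((m - 1) * p₁ ^ 2 - m * p₀ * p₂) := by
        rcases eq_or_ne t a with h | h
        · have := mul_ne_zero hm.ne' (hpa h)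
          subst h
          simp only [sub_self, zero_mul, sub_zero]
          positivity
        · have := sub_ne_zero.mpr h
          positivity
      linarith

open Polynomial in
/-- Between two zeros of `f` there is a zero of `g`, if their Wronskian never vanishes. -/
theorem exists_root_of_wronskian_ne_zero {f g : ℝ[X]}
    (hW : ∀ t, (derivative f).eval t * g.eval t - f.eval t * (derivative g).eval t ≠ 0)
    {a b : ℝ} (hab : a < b) (hfa : f.eval a = 0) (hfb : f.eval b = 0) :
    ∃ c ∈ Set.Ioo a b, g.eval c = 0 := by
  by_contra! hg
  have hg' : ∀ c ∈ Set.Icc a b, g.eval c ≠ 0 := by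
    intro c hc h
    rcases hc.1.eq_or_lt with rfl | h1
    · exact hW a (by simp [h, hfa])
    rcases hc.2.eq_or_lt with rfl | h2
    · exact hW c (by simp [h, hfb])
    exact hg c ⟨h1, h2⟩ h
  obtain ⟨c, hc, h⟩ := exists_hasDerivAt_eq_zero (f := fun t => f.eval t / g.eval t) hab
    (f.continuousOn.div g.continuousOn hg') (by simp [hfa, hfb])
    fun t ht => (f.hasDerivAt t).div (g.hasDerivAt t) (hg' t (Set.Ioo_subset_Icc_self ht))
  rcases div_eq_zero_iff.mp h with h | h
  · exact hW c h
  · exact hg c hc (pow_eq_zero_iff two_ne_zero |>.mp h)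

open Polynomial in
theorem rootMultiplicity_eq_one_of_derivative_ne_zero {f : ℝ[X]} {t : ℝ}
    (hf : f.eval t = 0) (hf' : (derivative f).eval t ≠ 0) : f.rootMultiplicity t = 1 := by
  have h0 : f ≠ 0 := by
    rintro rfl
    simp at hf'
  have h1 : 0 < f.rootMultiplicity t := (rootMultiplicity_pos h0).mpr hf
  have h2 : ¬ 1 < f.rootMultiplicity t := fun h =>
    hf' ((one_lt_rootMultiplicity_iff_isRoot h0).mp h).2
  omega

open Polynomial in
/-- Lemma 2.2: for `x_1 < ⋯ < x_n`, all real roots of `P₁ = P'/n` and of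
`P₂ = t·P₁ − P` are simple, and `P₂` has exactly one real root in each open interval
between consecutive roots `y_1 < ⋯ < y_{n-1}` of `P₁`. -/
theorem roots_interleaved (n : ℕ) (hn : 3 ≤ n) (x : Fin n → ℝ) (hx : StrictMono x)
    (P P₁ P₂ : Polynomial ℝ)
    (hP : P = ∏ i : Fin n, (X - C (x i)))
    (hP₁ : P₁ = C ((n : ℝ)⁻¹) * Polynomial.derivative P)
    (hP₂ : P₂ = X * P₁ - P)
    (y : ℕ → ℝ)
    (hymono : ∀ i j : ℕ, i < j → j < n - 1 → y i < y j)
    (hyroot : ∀ i : ℕ, i < n - 1 → P₁.eval (y i) = 0) :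
    (∀ t : ℝ, P₁.eval t = 0 → Polynomial.rootMultiplicity t P₁ = 1)
    ∧ (∀ t : ℝ, P₂.eval t = 0 → Polynomial.rootMultiplicity t P₂ = 1)
    ∧ (∀ i : ℕ, i + 1 < n - 1 →
        ∃! z : ℝ, z ∈ Set.Ioo (y i) (y (i + 1)) ∧ P₂.eval z = 0) := by
  have hn0 : (n : ℝ) ≠ 0 := by positivity
  have hPs : P = ∏ a ∈ Finset.univ.image x, (X - C a) := by
    rw [hP, Finset.prod_image (fun i _ j _ h => hx.injective h)]
  have hcard : (Finset.univ.image x).card = n := by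
    rw [Finset.card_image_of_injective _ hx.injective, Finset.card_fin]
  have hL := laguerre_pos_of_two_le_card (Finset.univ.image x) (by omega)
  rw [hcard, ← hPs] at hL
  have hW : ∀ t, (derivative P₁).eval t * P₂.eval t - P₁.eval t * (derivative P₂).eval t ≠ 0 := by
    intro t
    have h := hL t
    have hid : (n : ℝ) ^ 2 *
        ((derivative P₁).eval t * P₂.eval t - P₁.eval t * (derivative P₂).eval t) =
        ((n : ℝ) - 1) * (derivative P).eval t ^ 2
          - n * P.eval t * (derivative (derivative P)).eval t := by
      simp only [hP₂, hP₁, derivative_mul, derivative_sub, derivative_X, derivative_C, zero_mul,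
        zero_add, one_mul, eval_add, eval_mul, eval_sub, eval_X, eval_C]
      field_simp
      ring
    intro h0
    rw [← hid, h0, mul_zero] at h
    exact lt_irrefl _ h
  have hW' : ∀ t, (derivative P₂).eval t * P₁.eval t - P₂.eval t * (derivative P₁).eval t ≠ 0 :=
    fun t h => hW t (by linarith)
  refine ⟨fun t ht => ?_, fun t ht => ?_, fun i hi => ?_⟩
  · exact rootMultiplicity_eq_one_of_derivative_ne_zero ht fun h => hW t (by simp [h, ht])
  · exact rootMultiplicity_eq_one_of_derivative_ne_zero ht fun h => hW t (by simp [h, ht])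
  have hP₁0 : P₁ ≠ 0 := by
    rintro h
    exact hW 0 (by simp [h])
  have hdeg : P₁.natDegree ≤ n - 1 := by
    have hPdeg : P.natDegree = n := by
      rw [hP, natDegree_prod_of_monic _ _ fun i _ => monic_X_sub_C _]
      simp
    rw [hP₁]
    exact (natDegree_C_mul_le _ _).trans ((natDegree_derivative_le _).trans (by rw [hPdeg]))
  have hno : ∀ w ∈ Set.Ioo (y i) (y (i + 1)), P₁.eval w ≠ 0 := by
    intro w hw hw0
    have hyinj : Set.InjOn y (Finset.range (n - 1)) := by
      intro j hj k hk h
      simp only [Finset.coe_range, Set.mem_Iio] at hj hk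
      rcases lt_trichotomy j k with hjk | hjk | hjk
      · exact absurd h (hymono j k hjk hk).ne
      · exact hjk
      · exact absurd h (hymono k j hjk hj).ne'
    have hwy : w ∉ (Finset.range (n - 1)).image y := by
      simp only [Finset.mem_image, Finset.mem_range, not_exists, not_and]
      rintro j hj rfl
      rcases lt_trichotomy j i with h | rfl | h
      · exact absurd (hymono j i h (by omega)) hw.1.not_gt
      · exact lt_irrefl _ hw.1
      · rcases (Nat.succ_le_of_lt h).eq_or_lt with h | h
        · subst h
          exact lt_irrefl _ hw.2
        · exact absurd (hymono (i + 1) j h hj) hw.2.not_gt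
    refine hP₁0 (eq_zero_of_natDegree_lt_card_of_eval_eq_zero' P₁
      (insert w ((Finset.range (n - 1)).image y)) ?_ ?_)
    · simp only [Finset.mem_insert, Finset.mem_image, Finset.mem_range]
      rintro _ (rfl | ⟨j, hj, rfl⟩)
      exacts [hw0, hyroot j hj]
    · rw [Finset.card_insert_of_notMem hwy, Finset.card_image_of_injOn hyinj, Finset.card_range]
      omega
  obtain ⟨z, hz, hz0⟩ := exists_root_of_wronskian_ne_zero hW
    (hymono i (i + 1) i.lt_succ_self hi) (hyroot i (by omega)) (hyroot (i + 1) hi)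
  have hlt : ∀ u ∈ Set.Ioo (y i) (y (i + 1)), ∀ v ∈ Set.Ioo (y i) (y (i + 1)),
      P₂.eval u = 0 → P₂.eval v = 0 → ¬ u < v := by
    intro u hu v hv hu0 hv0 huv
    obtain ⟨w, hw, hw0⟩ := exists_root_of_wronskian_ne_zero hW' huv hu0 hv0
    exact hno w ⟨hu.1.trans hw.1, hw.2.trans hv.2⟩ hw0
  refine ⟨z, ⟨hz, hz0⟩, fun u ⟨hu, hu0⟩ => ?_⟩
  exact le_antisymm (not_lt.mp (hlt z hz u hu hz0 hu0)) (not_lt.mp (hlt u hu z hz hu0 hz0))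
end
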